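/- Let g and k be positive integers, and let A ∈ 𝒜_k. If 3k ≤ g + |A| + |(A + A) ∩ [0, k]| − 2, then the number of numerical semigroups with genus g and type (A; k) is exactly the Fibonacci number F_{g − |(A + A) ∩ [0, k]| + |A| − k − 1}. -/

import Mathlib

open Pointwise

/-- A numerical semigroup: a set of nonnegative integers containing `0`,
closed under addition, with finite complement in `ℕ`. -/
def IsNumericalSemigroup (Λ : Set ℕ) : Prop :=
  0 ∈ Λ ∧ (∀ a ∈ Λ, ∀ b ∈ Λ, a + b ∈ Λ) ∧ (Λᶜ).Finite

/-- The multiplicity `m(Λ)`: the smallest nonzero element of `Λ`. -/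
noncomputable def mult (Λ : Set ℕ) : ℕ := sInf {n | n ∈ Λ ∧ n ≠ 0}

/-- The Frobenius number `f(Λ)`: the largest nonnegative integer not in `Λ`. -/
noncomputable def frob (Λ : Set ℕ) : ℕ := sSup Λᶜ

/-- The genus `g(Λ)`: the number of nonnegative integers not in `Λ`. -/
noncomputable def genus (Λ : Set ℕ) : ℕ := Λᶜ.ncard

/-- Fibonacci numbers indexed by `ℤ`, with `F_n = 0` for `n ≤ 0`,
`F_1 = F_2 = 1`, `F_{n+2} = F_{n+1} + F_n`. -/
def fibZ (n : ℤ) : ℕ := if 0 < n then Nat.fib n.toNat else 0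

/-- Binomial coefficient `C(a, b)` for integers, interpreted as `0` unless `0 ≤ b ≤ a`. -/
def chooseZ (a b : ℤ) : ℕ := if 0 ≤ b ∧ b ≤ a then a.toNat.choose b.toNat else 0

/-- `𝒜_k`: the collection of subsets `A ⊆ [0, k-1]` with `0 ∈ A` and `k ∉ A + A`. -/
def AkSet (k : ℕ) : Finset (Finset ℕ) :=
  (Finset.range k).powerset.filter (fun A => 0 ∈ A ∧ k ∉ A + A)

/-- A numerical semigroup `Λ` (with multiplicity `m = m(Λ)`) has type `(A; k)` if
`f(Λ) = 2m + k` and `Λ ∩ [m, m+k] = A + m`. -/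
noncomputable def HasType (Λ : Set ℕ) (k : ℕ) (A : Finset ℕ) : Prop :=
  frob Λ = 2 * mult Λ + k ∧
    Λ ∩ Set.Icc (mult Λ) (mult Λ + k) = (fun a => a + mult Λ) '' (A : Set ℕ)

/-- `t_g`: the number of numerical semigroups of genus `g` with `f < 3m`. -/
noncomputable def tCount (g : ℕ) : ℕ :=
  {Λ : Set ℕ | IsNumericalSemigroup Λ ∧ genus Λ = g ∧ frob Λ < 3 * mult Λ}.ncard

/-- `n_g`: the number of numerical semigroups of genus `g`. -/
noncomputable def nCount (g : ℕ) : ℕ :=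
  {Λ : Set ℕ | IsNumericalSemigroup Λ ∧ genus Λ = g}.ncard


lemma IsNumericalSemigroup.mult_spec {Λ : Set ℕ} (hΛ : IsNumericalSemigroup Λ) :
    mult Λ ∈ Λ ∧ mult Λ ≠ 0 := by
  have hne : {n | n ∈ Λ ∧ n ≠ 0}.Nonempty := by
    obtain ⟨n, hn⟩ := (hΛ.2.2.union (Set.finite_singleton 0)).exists_notMem
    simp only [Set.mem_union, Set.mem_compl_iff, Set.mem_singleton_iff, not_or, not_not] at hn
    exact ⟨n, hn⟩
  exact Nat.sInf_mem hne

lemma mult_le {Λ : Set ℕ} {n : ℕ} (hn : n ∈ Λ) (h0 : n ≠ 0) : mult Λ ≤ n :=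
  Nat.sInf_le ⟨hn, h0⟩

lemma mult_eq {Λ : Set ℕ} {m : ℕ} (hm : m ∈ Λ) (h0 : m ≠ 0)
    (hle : ∀ n ∈ Λ, n ≠ 0 → m ≤ n) : mult Λ = m :=
  IsLeast.csInf_eq ⟨⟨hm, h0⟩, fun n hn => hle n hn.1 hn.2⟩

lemma frob_notMem {Λ : Set ℕ} (hfin : (Λᶜ).Finite) (hpos : frob Λ ≠ 0) : frob Λ ∉ Λ := by
  have hne : (Λᶜ).Nonempty := by
    by_contra hc
    rw [Set.not_nonempty_iff_eq_empty] at hc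
    exact hpos (by simp [frob, hc])
  exact Nat.sSup_mem hne hfin.bddAbove

lemma le_frob {Λ : Set ℕ} (hfin : (Λᶜ).Finite) {n : ℕ} (hn : n ∉ Λ) : n ≤ frob Λ :=
  le_csSup hfin.bddAbove hn

lemma frob_eq {Λ : Set ℕ} {f : ℕ} (hf : f ∉ Λ) (hle : ∀ n ∉ Λ, n ≤ f) : frob Λ = f :=
  IsGreatest.csSup_eq ⟨hf, fun n hn => hle n hn⟩

lemma mem_AkSet {k : ℕ} {A : Finset ℕ} :
    A ∈ AkSet k ↔ (∀ a ∈ A, a < k) ∧ 0 ∈ A ∧ k ∉ A + A := by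
  simp [AkSet, Finset.subset_iff]

/-- The positions which may or may not be gaps of a semigroup of type `(A; k)` and
multiplicity `m`. -/
def freePositions (A : Finset ℕ) (k m : ℕ) : Finset ℕ :=
  Finset.Ico (m + k + 1) (2 * m) ∪
    (Finset.range k \ (A + A).filter (fun x => x ≤ k)).image (2 * m + ·)

/-- The gaps of the semigroup of type `(A; k)` and multiplicity `m` whose gaps among the free
positions are the elements of `D`. -/
def gapSet (A : Finset ℕ) (k m : ℕ) (D : Finset ℕ) : Finset ℕ :=
  Finset.Ico 1 m ∪ ((Finset.range (k + 1) \ A).image (m + ·) ∪ (D ∪ {2 * m + k}))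

lemma mem_freePositions {A : Finset ℕ} {k m n : ℕ} :
    n ∈ freePositions A k m ↔
      m + k + 1 ≤ n ∧ n < 2 * m ∨ 2 * m ≤ n ∧ n < 2 * m + k ∧ n - 2 * m ∉ A + A := by
  simp only [freePositions, Finset.mem_union, Finset.mem_Ico, Finset.mem_image, Finset.mem_sdiff,
    Finset.mem_range, Finset.mem_filter]
  constructor
  · rintro (h | ⟨a, ⟨ha, hb⟩, rfl⟩)
    · exact .inl h
    · refine .inr ⟨by omega, by omega, ?_⟩
      rw [Nat.add_sub_cancel_left]
      exact fun hc => hb ⟨hc, ha.le⟩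
  · rintro (h | ⟨h1, h2, h3⟩)
    · exact .inl h
    · exact .inr ⟨n - 2 * m, ⟨by omega, fun hc => h3 hc.1⟩, by omega⟩

lemma mem_gapSet {A D : Finset ℕ} {k m n : ℕ} :
    n ∈ gapSet A k m D ↔
      (1 ≤ n ∧ n < m) ∨ (m ≤ n ∧ n ≤ m + k ∧ n - m ∉ A) ∨ n ∈ D ∨ n = 2 * m + k := by
  simp only [gapSet, Finset.mem_union, Finset.mem_Ico, Finset.mem_image, Finset.mem_sdiff,
    Finset.mem_range, Finset.mem_singleton]
  refine or_congr_right (or_congr_left ⟨?_, ?_⟩)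
  · rintro ⟨a, ⟨ha, hb⟩, rfl⟩
    exact ⟨by omega, by omega, by rwa [Nat.add_sub_cancel_left]⟩
  · rintro ⟨h1, h2, h3⟩
    exact ⟨n - m, ⟨by omega, h3⟩, by omega⟩

lemma filter_add_subset_range {A : Finset ℕ} {k : ℕ} (hA : A ∈ AkSet k) :
    (A + A).filter (fun x => x ≤ k) ⊆ Finset.range k := by
  intro x hx
  rw [Finset.mem_filter] at hx
  rw [Finset.mem_range]
  refine lt_of_le_of_ne hx.2 ?_
  rintro rfl
  exact (mem_AkSet.1 hA).2.2 hx.1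

lemma card_freePositions {A : Finset ℕ} {k m : ℕ} (hA : A ∈ AkSet k) (hm : k < m) :
    (freePositions A k m).card = m - 1 - ((A + A).filter (fun x => x ≤ k)).card := by
  have hT := filter_add_subset_range hA
  have hc := Finset.card_le_card hT
  rw [freePositions, Finset.card_union_of_disjoint, Finset.card_image_of_injective _
    (add_right_injective _), Finset.card_sdiff_of_subset hT, Nat.card_Ico, Finset.card_range]
  · rw [Finset.card_range] at hc
    omega
  · rw [Finset.disjoint_left]
    intro n hn hn'
    simp only [Finset.mem_Ico, Finset.mem_image] at hn hn'
    obtain ⟨a, -, rfl⟩ := hn'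
    omega

lemma card_gapSet {A D : Finset ℕ} {k m : ℕ} (hA : A ∈ AkSet k) (hm : k < m)
    (hD : D ⊆ freePositions A k m) :
    (gapSet A k m D).card + A.card = m + D.card + k + 1 := by
  have hAr : A ⊆ Finset.range (k + 1) := fun a ha => by
    have := (mem_AkSet.1 hA).1 a ha
    simp; omega
  have hc := Finset.card_le_card hAr
  have hD' : ∀ n ∈ D, m + k < n ∧ n < 2 * m + k := fun n hn => by
    have := mem_freePositions.1 (hD hn)
    omega
  rw [gapSet, Finset.card_union_of_disjoint, Finset.card_union_of_disjoint,
    Finset.card_union_of_disjoint, Finset.card_image_of_injective _ (add_right_injective _),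
    Finset.card_sdiff_of_subset hAr, Nat.card_Ico, Finset.card_range, Finset.card_singleton]
  · rw [Finset.card_range] at hc
    omega
  · rw [Finset.disjoint_singleton_right]
    exact fun hn => by have := hD' _ hn; omega
  · rw [Finset.disjoint_left]
    intro n hn hn'
    simp only [Finset.mem_image, Finset.mem_sdiff, Finset.mem_range, Finset.mem_union,
      Finset.mem_singleton] at hn hn'
    obtain ⟨a, ⟨ha, -⟩, rfl⟩ := hn
    rcases hn' with hn' | hn'
    · have := hD' _ hn'; omega
    · omega
  · rw [Finset.disjoint_left]
    intro n hn hn'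
    simp only [Finset.mem_image, Finset.mem_union, Finset.mem_singleton, Finset.mem_Ico] at hn hn'
    rcases hn' with ⟨a, -, rfl⟩ | hn' | hn'
    · omega
    · have := hD' _ hn'; omega
    · omega

section Construction

variable {A D : Finset ℕ} {k m : ℕ}

lemma isNumericalSemigroup_compl_gapSet (hA : A ∈ AkSet k) (hm : k < m)
    (hD : D ⊆ freePositions A k m) :
    IsNumericalSemigroup ((gapSet A k m D : Set ℕ)ᶜ) := by
  have hD' := fun n hn => mem_freePositions.1 (@hD n hn)
  obtain ⟨hlt, h0, hkA⟩ := mem_AkSet.1 hA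
  refine ⟨?_, ?_, by simp⟩
  · rw [Set.mem_compl_iff, Finset.mem_coe, mem_gapSet]
    have := hD' 0
    rintro (h | h | h | h)
    · omega
    · omega
    · have := hD' 0 h
      omega
    · omega
  · intro a ha b hb
    rw [Set.mem_compl_iff, Finset.mem_coe] at ha hb ⊢
    rcases Nat.eq_zero_or_pos a with rfl | ha0
    · simpa using hb
    rcases Nat.eq_zero_or_pos b with rfl | hb0
    · simpa using ha
    rw [mem_gapSet] at ha hb
    push Not at ha hb
    have ham := ha.1 ha0
    have hbm := hb.1 hb0
    have hsum : a + b ≤ 2 * m + k → a + b - 2 * m ∈ A + A := fun h => by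
      rw [Finset.mem_add]
      exact ⟨a - m, ha.2.1 ham (by omega), b - m, hb.2.1 hbm (by omega), by omega⟩
    rw [mem_gapSet]
    rintro (h | h | h | h)
    · omega
    · omega
    · rcases hD' _ h with h | h
      · omega
      · exact h.2.2 (hsum (by omega))
    · apply hkA
      have := hsum h.le
      rwa [h, Nat.add_sub_cancel_left] at this

lemma mult_compl_gapSet (hA : A ∈ AkSet k) (hm : k < m) (hD : D ⊆ freePositions A k m) :
    mult ((gapSet A k m D : Set ℕ)ᶜ) = m := by
  refine mult_eq ?_ (by omega) ?_
  · rw [Set.mem_compl_iff, Finset.mem_coe, mem_gapSet]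
    rintro (h | h | h | h)
    · omega
    · apply h.2.2
      rw [Nat.sub_self]
      exact (mem_AkSet.1 hA).2.1
    · have := mem_freePositions.1 (hD h)
      omega
    · omega
  · intro n hn hn0
    rw [Set.mem_compl_iff, Finset.mem_coe, mem_gapSet] at hn
    by_contra hc
    exact hn (.inl (by omega))

lemma frob_compl_gapSet (hD : D ⊆ freePositions A k m) :
    frob ((gapSet A k m D : Set ℕ)ᶜ) = 2 * m + k := by
  refine frob_eq ?_ ?_
  · rw [Set.mem_compl_iff, Finset.mem_coe, mem_gapSet]
    simp
  · intro n hn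
    rw [Set.mem_compl_iff, Finset.mem_coe, mem_gapSet, not_not] at hn
    rcases hn with h | h | h | h
    · omega
    · omega
    · have := mem_freePositions.1 (hD h)
      omega
    · omega

lemma hasType_compl_gapSet (hA : A ∈ AkSet k) (hm : k < m) (hD : D ⊆ freePositions A k m) :
    HasType ((gapSet A k m D : Set ℕ)ᶜ) k A := by
  rw [HasType, mult_compl_gapSet hA hm hD, frob_compl_gapSet hD]
  refine ⟨rfl, ?_⟩
  ext n
  simp only [Set.mem_inter_iff, Set.mem_compl_iff, Finset.mem_coe, mem_gapSet, Set.mem_Icc,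
    Set.mem_image]
  constructor
  · rintro ⟨h1, h2, h3⟩
    push Not at h1
    exact ⟨n - m, h1.2.1 h2 h3, by omega⟩
  · rintro ⟨a, ha, rfl⟩
    have hak := (mem_AkSet.1 hA).1 a ha
    refine ⟨?_, by omega, by omega⟩
    rintro (h | h | h | h)
    · omega
    · rw [Nat.add_sub_cancel] at h
      exact h.2.2 ha
    · have := mem_freePositions.1 (hD h)
      omega
    · omega

lemma gapSet_inter_freePositions (hm : k < m) (hD : D ⊆ freePositions A k m) :
    gapSet A k m D ∩ freePositions A k m = D := by
  ext n
  rw [Finset.mem_inter]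
  refine ⟨fun ⟨h, h'⟩ => ?_, fun h => ⟨mem_gapSet.2 (.inr (.inr (.inl h))), hD h⟩⟩
  rw [mem_freePositions] at h'
  rcases mem_gapSet.1 h with h | h | h | h
  · omega
  · omega
  · exact h
  · omega

end Construction

section Structure

variable {Λ : Set ℕ} {A : Finset ℕ} {k : ℕ}

lemma HasType.mem_iff (hT : HasType Λ k A) {n : ℕ} (h1 : mult Λ ≤ n) (h2 : n ≤ mult Λ + k) :
    n ∈ Λ ↔ n - mult Λ ∈ A := by
  have := Set.ext_iff.1 hT.2 n
  simp only [Set.mem_inter_iff, Set.mem_Icc, Set.mem_image, Finset.mem_coe] at this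
  constructor
  · intro h
    obtain ⟨a, ha, rfl⟩ := this.1 ⟨h, h1, h2⟩
    rwa [Nat.add_sub_cancel]
  · intro h
    exact (this.2 ⟨_, h, by omega⟩).1

lemma HasType.mem_of_mem_add (hA : A ∈ AkSet k) (hΛ : IsNumericalSemigroup Λ)
    (hT : HasType Λ k A) {n : ℕ} (h1 : 2 * mult Λ ≤ n) (h2 : n - 2 * mult Λ ∈ A + A) :
    n ∈ Λ := by
  obtain ⟨a, ha, b, hb, hab⟩ := Finset.mem_add.1 h2
  have key : ∀ a ∈ A, mult Λ + a ∈ Λ := fun a ha => by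
    have := (mem_AkSet.1 hA).1 a ha
    rw [hT.mem_iff (by omega) (by omega), Nat.add_sub_cancel_left]
    exact ha
  have := hΛ.2.1 _ (key a ha) _ (key b hb)
  convert this using 1
  omega

/-- A semigroup with `f = 2m + k` and `k ≥ m` has too few gaps to satisfy the genus bound. -/
lemma HasType.lt_mult (hA : A ∈ AkSet k) (hΛ : IsNumericalSemigroup Λ) (hT : HasType Λ k A)
    (h : 3 * k + 2 ≤ genus Λ + A.card + ((A + A).filter (fun x => x ≤ k)).card) :
    k < mult Λ := by
  by_contra! hle
  have hm0 := hΛ.mult_spec.2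
  set m := mult Λ with hm
  set T := (A + A).filter (fun x => x ≤ k) with hTdef
  have hTk : T ⊆ Finset.range (k + 1) :=
    (filter_add_subset_range hA).trans (Finset.range_subset_range.2 (by omega))
  have hsub : Λᶜ ⊆ ((Finset.Ico 1 m ∪ ((Finset.range m \ A).image (m + ·) ∪
      (Finset.range (k + 1) \ T).image (2 * m + ·)) : Finset ℕ) : Set ℕ) := by
    intro n hn
    have hnf := le_frob hΛ.2.2 hn
    rw [hT.1, ← hm] at hnf
    simp only [Finset.mem_coe, Finset.mem_union, Finset.mem_Ico, Finset.mem_image,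
      Finset.mem_sdiff, Finset.mem_range]
    have hn0 : n ≠ 0 := by
      rintro rfl
      exact hn hΛ.1
    rcases lt_or_ge n m with h1 | h1
    · exact .inl (by omega)
    rcases lt_or_ge n (2 * m) with h2 | h2
    · refine .inr (.inl ⟨n - m, ⟨by omega, fun hc => hn ?_⟩, by omega⟩)
      exact (hT.mem_iff h1 (by omega)).2 hc
    · refine .inr (.inr ⟨n - 2 * m, ⟨by omega, fun hc => hn ?_⟩, by omega⟩)
      exact hT.mem_of_mem_add hA hΛ h2 (Finset.mem_filter.1 hc).1
  have hg := Set.ncard_le_ncard hsub (Finset.finite_toSet _)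
  rw [Set.ncard_coe_finset] at hg
  have c1 := Finset.card_union_le (Finset.Ico 1 m) ((Finset.range m \ A).image (m + ·) ∪
      (Finset.range (k + 1) \ T).image (2 * m + ·))
  have c2 := Finset.card_union_le ((Finset.range m \ A).image (m + ·))
    ((Finset.range (k + 1) \ T).image (2 * m + ·))
  rw [Finset.card_image_of_injective _ (add_right_injective _),
    Finset.card_image_of_injective _ (add_right_injective _),
    Finset.card_sdiff_of_subset hTk, Finset.card_range] at c2
  rw [Nat.card_Ico] at c1
  have c3 : A.card + (Finset.range m \ A).card ≤ k := by
    rw [← Finset.card_union_of_disjoint Finset.disjoint_sdiff]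
    refine (Finset.card_le_card (t := Finset.range k) ?_).trans_eq (Finset.card_range k)
    intro x hx
    rw [Finset.mem_union, Finset.mem_sdiff, Finset.mem_range] at hx
    rw [Finset.mem_range]
    rcases hx with hx | hx
    · exact (mem_AkSet.1 hA).1 x hx
    · omega
  have c4 := Finset.card_le_card hTk
  rw [Finset.card_range] at c4
  unfold genus at h
  omega

open Classical in
lemma HasType.compl_eq_gapSet (hA : A ∈ AkSet k) (hk : 0 < k) (hΛ : IsNumericalSemigroup Λ)
    (hT : HasType Λ k A) (hm : k < mult Λ) :
    Λᶜ = (gapSet A k (mult Λ) ((freePositions A k (mult Λ)).filter (· ∉ Λ)) : Set ℕ) := by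
  ext n
  rw [Set.mem_compl_iff, Finset.mem_coe, mem_gapSet, Finset.mem_filter, mem_freePositions]
  have hf : 2 * mult Λ + k ∉ Λ := by
    rw [← hT.1]
    exact frob_notMem hΛ.2.2 (by rw [hT.1]; omega)
  constructor
  · intro hn
    have hnf := le_frob hΛ.2.2 hn
    rw [hT.1] at hnf
    have hn0 : n ≠ 0 := by
      rintro rfl
      exact hn hΛ.1
    rcases lt_or_ge n (mult Λ) with h1 | h1
    · exact .inl (by omega)
    rcases le_or_gt n (mult Λ + k) with h2 | h2
    · exact .inr (.inl ⟨h1, h2, fun hc => hn ((hT.mem_iff h1 h2).2 hc)⟩)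
    rcases lt_or_ge n (2 * mult Λ) with h3 | h3
    · exact .inr (.inr (.inl ⟨.inl ⟨h2, h3⟩, hn⟩))
    rcases hnf.eq_or_lt with h4 | h4
    · exact .inr (.inr (.inr h4))
    · exact .inr (.inr (.inl
        ⟨.inr ⟨h3, h4, fun hc => hn (hT.mem_of_mem_add hA hΛ h3 hc)⟩, hn⟩))
  · rintro (h | h | h | rfl)
    · intro hn
      have := mult_le hn (by omega)
      omega
    · exact fun hn => h.2.2 ((hT.mem_iff h.1 h.2.1).1 hn)
    · exact h.2
    · exact hf

end Structure

lemma sum_choose_eq_fib {t k G : ℕ} (ht : t ≤ k) (hG : 2 * k + 1 ≤ G + t) (hkG : t < G) :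
    ∑ m ∈ Finset.Ioc k G, (m - 1 - t).choose (G - m) = Nat.fib (G - t) := by
  obtain ⟨N, rfl⟩ : ∃ N, G = N + t + 1 := ⟨G - t - 1, by omega⟩
  have hsub : Finset.Ioc k (N + t + 1) ⊆ Finset.Ico (t + 1) (N + t + 1 + 1) := by
    intro m hm
    rw [Finset.mem_Ioc] at hm
    rw [Finset.mem_Ico]
    omega
  rw [Finset.sum_subset hsub, Finset.sum_Ico_eq_sum_range,
    show N + t + 1 - t = N + 1 by omega, Nat.fib_succ_eq_sum_choose,
    Finset.Nat.sum_antidiagonal_eq_sum_range_succ_mk,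
    show N + t + 1 + 1 - (t + 1) = N + 1 by omega]
  · refine Finset.sum_congr rfl fun n _ => ?_
    congr 1 <;> omega
  · intro m hm hm'
    rw [Finset.mem_Ico] at hm
    rw [Finset.mem_Ioc] at hm'
    exact Nat.choose_eq_zero_of_lt (by omega)

lemma setOf_hasType_eq_image {g k : ℕ} (hk : 0 < k) {A : Finset ℕ} (hA : A ∈ AkSet k)
    (h : 3 * k + 2 ≤ g + A.card + ((A + A).filter (fun x => x ≤ k)).card) :
    {Λ : Set ℕ | IsNumericalSemigroup Λ ∧ genus Λ = g ∧ HasType Λ k A} =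
      (fun p : (_ : ℕ) × Finset ℕ => (gapSet A k p.1 p.2 : Set ℕ)ᶜ) ''
        ((Finset.Ioc k (g + A.card - k - 1)).sigma fun m =>
          (freePositions A k m).powersetCard (g + A.card - k - 1 - m) :
            Finset ((_ : ℕ) × Finset ℕ)) := by
  classical
  ext Λ
  simp only [Set.mem_ofPred_eq, Set.mem_image, Finset.mem_coe, Finset.mem_sigma, Finset.mem_Ioc,
    Finset.mem_powersetCard]
  constructor
  · rintro ⟨hΛ, rfl, hT⟩
    have hm := hT.lt_mult hA hΛ h
    have hc := hT.compl_eq_gapSet hA hk hΛ hm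
    have hcard := card_gapSet hA hm
      (Finset.filter_subset (· ∉ Λ) (freePositions A k (mult Λ)))
    have hg : genus Λ = _ := congrArg Set.ncard hc
    rw [Set.ncard_coe_finset] at hg
    refine ⟨⟨mult Λ, (freePositions A k (mult Λ)).filter (· ∉ Λ)⟩,
      ⟨⟨hm, ?_⟩, Finset.filter_subset _ _, ?_⟩, ?_⟩
    · dsimp only
      omega
    · dsimp only
      omega
    · dsimp only
      rw [← hc, compl_compl]
  · rintro ⟨⟨m, D⟩, ⟨⟨hm, hmG⟩, hD, hDc⟩, rfl⟩
    dsimp only at *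
    refine ⟨isNumericalSemigroup_compl_gapSet hA hm hD, ?_, hasType_compl_gapSet hA hm hD⟩
    rw [genus, compl_compl, Set.ncard_coe_finset]
    have := card_gapSet hA hm hD
    omega

lemma injOn_compl_gapSet {k : ℕ} {A : Finset ℕ} (hA : A ∈ AkSet k) :
    Set.InjOn (fun p : (_ : ℕ) × Finset ℕ => (gapSet A k p.1 p.2 : Set ℕ)ᶜ)
      {p | k < p.1 ∧ p.2 ⊆ freePositions A k p.1} := by
  rintro ⟨m, D⟩ ⟨hm, hD⟩ ⟨m', D'⟩ ⟨hm', hD'⟩ heq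
  dsimp only at *
  obtain rfl : m = m' := by
    rw [← mult_compl_gapSet hA hm hD, heq, mult_compl_gapSet hA hm' hD']
  have hgap : gapSet A k m D = gapSet A k m D' := Finset.coe_injective (compl_injective heq)
  rw [← gapSet_inter_freePositions hm hD, hgap, gapSet_inter_freePositions hm hD']

/-- For positive integers `g, k` and `A ∈ 𝒜_k`, if
`3k ≤ g + |A| + |(A+A) ∩ [0,k]| - 2` then the number of numerical semigroups with genus
`g` and type `(A; k)` equals `F_{g - |(A+A)∩[0,k]| + |A| - k - 1}`. -/
theorem statement9 (g k : ℕ) (hg : 0 < g) (hk : 0 < k) (A : Finset ℕ) (hA : A ∈ AkSet k)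
    (h : 3 * (k : ℤ) ≤ (g : ℤ) + A.card + ((A + A).filter (fun x => x ≤ k)).card - 2) :
    {Λ : Set ℕ | IsNumericalSemigroup Λ ∧ genus Λ = g ∧ HasType Λ k A}.ncard =
      fibZ ((g : ℤ) - ((A + A).filter (fun x => x ≤ k)).card + A.card - k - 1) := by
  replace h : 3 * k + 2 ≤ g + A.card + ((A + A).filter (fun x => x ≤ k)).card := by omega
  have ht := Finset.card_le_card (filter_add_subset_range hA)
  rw [Finset.card_range] at ht
  rw [setOf_hasType_eq_image hk hA h, Set.InjOn.ncard_image, Set.ncard_coe_finset,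
    Finset.card_sigma]
  · set t := ((A + A).filter (fun x => x ≤ k)).card
    rw [fibZ, if_pos (by omega), show ((g : ℤ) - t + A.card - k - 1).toNat =
      g + A.card - k - 1 - t by omega,
      ← sum_choose_eq_fib (k := k) ht (by omega) (by omega)]
    refine Finset.sum_congr rfl fun m hm => ?_
    rw [Finset.card_powersetCard, card_freePositions hA (Finset.mem_Ioc.1 hm).1]
  · refine (injOn_compl_gapSet hA).mono fun p hp => ?_
    rw [Finset.mem_coe, Finset.mem_sigma, Finset.mem_Ioc, Finset.mem_powersetCard] at hp
    exact ⟨hp.1.1, hp.2.1⟩
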